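/- arXiv:math/0611625 — 2 statements merged into one kernel-verified Lean document; each statement's English description precedes it below -/
import Mathlib

section
/- Let Ω be an open subset of ℝ^d and let θ : Ω × T^d → ℝ be a Bochner-integrable map from Ω into C(T^d), i.e. for a.e. x the function v ↦ θ(x,v) is continuous and ℤ^d-periodic, x ↦ θ(x,·) is measurable as a map into the Banach space C(T^d), and ∫_Ω sup_{v∈T^d} |θ(x,v)| dx < ∞. Then, as ε → 0⁺, ∫_Ω θ(x, x/ε) dx converges to ∫_Ω ∫_{T^d} θ(x,v) dv dx. -/
open MeasureTheory Filter Topology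

instance : Fact ((0:ℝ) < 1) := ⟨one_pos⟩

/-- The `d`-dimensional torus `T^d = ℝ^d/ℤ^d`. -/
abbrev Torus (d : ℕ) := Fin d → AddCircle (1 : ℝ)

/-- The quotient map `ℝ^d → T^d`. -/
noncomputable def torusProj {d : ℕ} (x : Fin d → ℝ) : Torus d := fun i => (x i : AddCircle (1 : ℝ))

theorem aux_torusProj_continuous {d : ℕ} : Continuous (torusProj (d := d)) := by
  unfold torusProj
  refine continuous_pi fun i => ?_
  exact (AddCircle.continuous_mk' (1:ℝ)).comp (continuous_apply i)

instance aux_prob : IsProbabilityMeasure (volume : Measure (AddCircle (1:ℝ))) :=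
  ⟨by simp [AddCircle.measure_univ]⟩

theorem aux_fourier_integral (n : ℤ) (hn : n ≠ 0) :
    ∫ x : AddCircle (1:ℝ), fourier n x = 0 :=
  integral_eq_zero_of_add_right_eq_neg (μ := volume)
    (fourier_add_half_inv_index hn one_pos)

theorem aux_mFourier_integral {d : ℕ} (n : Fin d → ℤ) (hn : n ≠ 0) :
    ∫ v : Torus d, UnitAddTorus.mFourier n v = 0 := by
  obtain ⟨i, hi⟩ := Function.ne_iff.mp hn
  have := integral_fintype_prod_volume_eq_prod
    (fun (i : Fin d) (x : AddCircle (1:ℝ)) => (fourier (n i) x : ℂ))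
  refine Eq.trans this ?_
  exact Finset.prod_eq_zero (Finset.mem_univ i) (aux_fourier_integral _ hi)

theorem aux_integral_lip {d : ℕ} {𝕜 : Type*} [RCLike 𝕜] (a b : C(Torus d, 𝕜)) :
    ‖(∫ v, a v) - ∫ v, b v‖ ≤ ‖a - b‖ := by
  rw [← integral_sub (a.continuous.integrable_of_hasCompactSupport (HasCompactSupport.of_compactSpace _))
    (b.continuous.integrable_of_hasCompactSupport (HasCompactSupport.of_compactSpace _))]
  refine (norm_integral_le_of_norm_le_const (C := ‖a - b‖)
    (Eventually.of_forall fun v => (a - b).norm_coe_le_norm v)).trans ?_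
  simp

theorem aux_integral_cont {d : ℕ} {𝕜 : Type*} [RCLike 𝕜] :
    Continuous (fun c : C(Torus d, 𝕜) => ∫ v, c v) := by
  refine LipschitzWith.continuous (K := 1) (LipschitzWith.of_dist_le_mul fun a b => ?_)
  simpa [dist_eq_norm] using aux_integral_lip a b

theorem aux_closed {E G : Type*} [NormedAddCommGroup E] [NormedAddCommGroup G] (l : Filter ℝ)
    (F : ℝ → E → G) (L : E → G) (hL : Continuous L) (C : ℝ)
    (hF : ∀ ε a b, ‖F ε a - F ε b‖ ≤ C * ‖a - b‖) :
    IsClosed {a | Tendsto (fun ε => F ε a) l (𝓝 (L a))} := by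
  have h : UniformEquicontinuous F := by
    apply LipschitzWith.uniformEquicontinuous F C.toNNReal
    intro ε
    refine LipschitzWith.of_dist_le_mul fun a b => ?_
    rw [dist_eq_norm, dist_eq_norm]
    exact (hF ε a b).trans (by gcongr; exact Real.le_coe_toNNReal C)
  exact h.equicontinuous.isClosed_setOfPred_tendsto hL

theorem aux_comp_integrable {d : ℕ} {𝕜 : Type*} [RCLike 𝕜] {μ : Measure (Fin d → ℝ)}
    {θ : (Fin d → ℝ) → C(Torus d, 𝕜)} (hθ : Integrable θ μ) (ε : ℝ) :
    Integrable (fun x => θ x (torusProj (ε⁻¹ • x))) μ := by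
  refine Integrable.mono' hθ.norm ?_ (Eventually.of_forall fun x => (θ x).norm_coe_le_norm _)
  have hp : Continuous fun x : Fin d → ℝ => torusProj (ε⁻¹ • x) :=
    aux_torusProj_continuous.comp (continuous_const_smul _)
  exact (continuous_eval (F := C(Torus d, 𝕜))).comp_aestronglyMeasurable
    (hθ.aestronglyMeasurable.prodMk hp.aestronglyMeasurable)

theorem aux_mFourier_tendsto {d : ℕ} (f : (Fin d → ℝ) → ℂ) (n : Fin d → ℤ) (hn : n ≠ 0) :
    Tendsto (fun ε : ℝ => ∫ x, f x * UnitAddTorus.mFourier n (torusProj (ε⁻¹ • x)))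
      (𝓝[>] (0:ℝ)) (𝓝 0) := by
  let w : StrongDual ℝ (Fin d → ℝ) :=
    ∑ i, (-(n i : ℝ)) • (ContinuousLinearMap.proj (R := ℝ) (φ := fun _ : Fin d => ℝ) i)
  have hw : ∀ x, w x = - ∑ i, (n i : ℝ) * x i := by
    intro x
    simp [w]
  have hw0 : w ≠ 0 := by
    obtain ⟨i, hi⟩ := Function.ne_iff.mp hn
    intro h
    have := hw (Pi.single i 1)
    rw [h] at this
    simp [Pi.single_apply] at this
    exact hi (by simpa using this)
  have ht : Tendsto (fun ε : ℝ => ε⁻¹ • w) (𝓝[>] (0:ℝ)) (cocompact (StrongDual ℝ (Fin d → ℝ))) := by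
    rw [← Metric.cobounded_eq_cocompact, ← tendsto_norm_atTop_iff_cobounded]
    simp only [norm_smul]
    exact (tendsto_norm_atTop_atTop.comp tendsto_inv_nhdsGT_zero).atTop_mul_const
      (norm_pos_iff.mpr hw0)
  have := (tendsto_integral_exp_smul_cocompact f volume).comp ht
  refine this.congr fun ε => ?_
  refine integral_congr_ae (Eventually.of_forall fun x => ?_)
  simp only [Circle.smul_def, smul_eq_mul]
  rw [mul_comm]
  congr 1
  rw [Real.fourierChar_apply]
  simp only [UnitAddTorus.mFourier, ContinuousMap.coe_mk, torusProj, fourier_coe_apply]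
  rw [← Complex.exp_sum]
  congr 1
  simp only [FunLike.coe_smul, Pi.smul_apply, hw, smul_eq_mul]
  push_cast
  simp only [Finset.mul_sum, Finset.sum_mul, mul_neg, neg_neg]
  refine Finset.sum_congr rfl fun i _ => ?_
  ring

theorem aux_const {d : ℕ} (f : (Fin d → ℝ) → ℂ) (hf : Integrable f) (g : C(Torus d, ℂ)) :
    Tendsto (fun ε : ℝ => ∫ x, f x * g (torusProj (ε⁻¹ • x)))
      (𝓝[>] (0:ℝ)) (𝓝 ((∫ x, f x) * ∫ v, g v)) := by
  have hint : ∀ (g : C(Torus d, ℂ)) (ε : ℝ),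
      Integrable (fun x => f x * g (torusProj (ε⁻¹ • x))) := by
    intro g ε
    simpa using aux_comp_integrable (hf.smul_const g) ε
  have hgi : ∀ g : C(Torus d, ℂ), Integrable (fun v => g v) := fun g =>
    g.continuous.integrable_of_hasCompactSupport (HasCompactSupport.of_compactSpace _)
  have hcl := aux_closed (𝓝[>] (0:ℝ))
    (fun (ε : ℝ) (g : C(Torus d, ℂ)) => ∫ x, f x * g (torusProj (ε⁻¹ • x)))
    (fun g => (∫ x, f x) * ∫ v, g v) (continuous_const.mul aux_integral_cont)
    (∫ x, ‖f x‖) (by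
      intro ε a b
      rw [← integral_sub (hint a ε) (hint b ε), ← integral_mul_const]
      refine norm_integral_le_of_norm_le (hf.norm.mul_const _) (Eventually.of_forall fun x => ?_)
      rw [← mul_sub, norm_mul]
      gcongr
      exact (a - b).norm_coe_le_norm _)
  have hmem : g ∈ (Submodule.span ℂ (Set.range (UnitAddTorus.mFourier (d := Fin d)))).topologicalClosure := by
    rw [UnitAddTorus.span_mFourier_closure_eq_top]; trivial
  refine closure_minimal ?_ hcl hmem
  intro g hg
  induction hg using Submodule.span_induction with
  | mem x h =>
    obtain ⟨n, rfl⟩ := h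
    by_cases hn : n = 0
    · subst hn
      simp [UnitAddTorus.mFourier_zero]
    · simpa [aux_mFourier_integral n hn] using aux_mFourier_tendsto f n hn
  | zero => simp
  | add a b _ _ ha hb =>
    have := Tendsto.add ha hb
    simp only [Set.mem_ofPred_eq, ContinuousMap.add_apply]
    rw [integral_add (hgi a) (hgi b), mul_add]
    refine this.congr fun ε => ?_
    rw [← integral_add (hint a ε) (hint b ε)]
    simp only [mul_add]
  | smul c a _ ha =>
    have := Tendsto.const_mul c ha
    simp only [Set.mem_ofPred_eq, ContinuousMap.smul_apply, smul_eq_mul]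
    rw [integral_const_mul, mul_left_comm]
    refine this.congr fun ε => ?_
    rw [← integral_const_mul]
    simp only [mul_left_comm]

theorem aux_const_real {d : ℕ} (f : (Fin d → ℝ) → ℝ) (hf : Integrable f) (g : C(Torus d, ℝ)) :
    Tendsto (fun ε : ℝ => ∫ x, f x * g (torusProj (ε⁻¹ • x)))
      (𝓝[>] (0:ℝ)) (𝓝 ((∫ x, f x) * ∫ v, g v)) := by
  have h := aux_const (fun x => (f x : ℂ)) hf.ofReal
    ⟨fun v => (g v : ℂ), Complex.continuous_ofReal.comp g.continuous⟩
  simp only [ContinuousMap.coe_mk, ← Complex.ofReal_mul, integral_complex_ofReal] at h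
  have h2 := (Complex.continuous_re.tendsto _).comp h
  simpa [Function.comp_def] using h2

/-- if `θ ∈ L¹(Ω; C(T^d))` (Bochner-integrable map into the Banach
space `C(T^d)`) then `∫_Ω θ(x, x/ε) dx → ∫_Ω ∫_{T^d} θ(x,v) dv dx` as `ε → 0⁺`. -/
theorem statement2 (d : ℕ) (Ω : Set (Fin d → ℝ)) (hΩ : IsOpen Ω)
    (θ : (Fin d → ℝ) → C(Torus d, ℝ))
    (hθ : Integrable θ (volume.restrict Ω)) :
    Tendsto (fun ε : ℝ => ∫ x in Ω, θ x (torusProj (ε⁻¹ • x))) (𝓝[>] (0:ℝ))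
      (𝓝 (∫ x in Ω, ∫ v : Torus d, θ x v)) := by
  have hgi : ∀ g : C(Torus d, ℝ), Integrable (fun v => g v) := fun g =>
    g.continuous.integrable_of_hasCompactSupport (HasCompactSupport.of_compactSpace _)
  have hii : ∀ {θ : (Fin d → ℝ) → C(Torus d, ℝ)}, Integrable θ (volume.restrict Ω) →
      Integrable (fun x => ∫ v, θ x v) (volume.restrict Ω) := by
    intro θ hθ
    refine hθ.norm.mono' (aux_integral_cont.comp_aestronglyMeasurable hθ.aestronglyMeasurable)
      (Eventually.of_forall fun x => ?_)
    simpa using aux_integral_lip (θ x) 0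
  refine Integrable.induction (μ := volume.restrict Ω) (fun θ : (Fin d → ℝ) → C(Torus d, ℝ) =>
    Tendsto (fun ε : ℝ => ∫ x in Ω, θ x (torusProj (ε⁻¹ • x))) (𝓝[>] (0:ℝ))
      (𝓝 (∫ x in Ω, ∫ v : Torus d, θ x v))) ?_ ?_ ?_ ?_ hθ
  · intro c s hs hμs
    have hsΩ : MeasurableSet (s ∩ Ω) := hs.inter hΩ.measurableSet
    rw [Measure.restrict_apply hs] at hμs
    have h := aux_const_real ((s ∩ Ω).indicator fun _ => (1:ℝ))
      ((integrable_indicator_iff hsΩ).2 (integrableOn_const hμs.ne)) c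
    have key : ∀ u : (Fin d → ℝ) → ℝ, ∫ x in Ω, s.indicator u x
        = ∫ x, (s ∩ Ω).indicator (fun _ => (1:ℝ)) x * u x := by
      intro u
      rw [← integral_indicator hΩ.measurableSet, Set.indicator_indicator, Set.inter_comm]
      congr 1
      ext x
      by_cases hx : x ∈ s ∩ Ω <;> simp [hx]
    have e1 : ∀ ε : ℝ, (∫ x in Ω, (s.indicator (fun _ => c) x) (torusProj (ε⁻¹ • x)))
        = ∫ x, (s ∩ Ω).indicator (fun _ => (1:ℝ)) x * c (torusProj (ε⁻¹ • x)) := by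
      intro ε
      rw [← key]
      congr 1
      ext x
      by_cases hx : x ∈ s <;> simp [hx]
    have e2 : (∫ x in Ω, ∫ v, (s.indicator (fun _ => c) x) v)
        = (∫ x, (s ∩ Ω).indicator (fun _ => (1:ℝ)) x) * ∫ v, c v := by
      rw [← integral_mul_const, ← key (fun _ => ∫ v, c v)]
      congr 1
      ext x
      by_cases hx : x ∈ s <;> simp [hx]
    simp only [e1, e2]
    exact h
  · intro f g _ hf hg h1 h2
    have := h1.add h2
    rw [← integral_add (hii hf) (hii hg)] at this
    simp only [Pi.add_apply, ContinuousMap.add_apply]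
    simp only [integral_add (hgi _) (hgi _)]
    refine this.congr fun ε => ?_
    rw [← integral_add (aux_comp_integrable hf ε) (aux_comp_integrable hg ε)]
  · have hnorm : ∀ a b : (Fin d → ℝ) →₁[volume.restrict Ω] C(Torus d, ℝ),
        ∫ x in Ω, ‖a x - b x‖ = ‖a - b‖ := by
      intro a b
      rw [L1.norm_eq_integral_norm]
      refine integral_congr_ae ?_
      filter_upwards [Lp.coeFn_sub a b] with x hx
      rw [hx]; rfl
    refine aux_closed (𝓝[>] (0:ℝ))
      (fun (ε : ℝ) (θ : (Fin d → ℝ) →₁[volume.restrict Ω] C(Torus d, ℝ)) =>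
        ∫ x in Ω, θ x (torusProj (ε⁻¹ • x)))
      (fun θ => ∫ x in Ω, ∫ v, θ x v) ?_ 1 ?_
    · refine LipschitzWith.continuous (K := 1) (LipschitzWith.of_dist_le_mul fun a b => ?_)
      have ha := L1.integrable_coeFn a
      have hb := L1.integrable_coeFn b
      rw [dist_eq_norm, dist_eq_norm, ← integral_sub (hii ha) (hii hb), ← hnorm]
      simp only [NNReal.coe_one, one_mul]
      exact norm_integral_le_of_norm_le (ha.sub hb).norm
        (Eventually.of_forall fun x => aux_integral_lip _ _)
    · intro ε a b
      have ha := L1.integrable_coeFn a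
      have hb := L1.integrable_coeFn b
      rw [← integral_sub (aux_comp_integrable ha ε) (aux_comp_integrable hb ε), ← hnorm, one_mul]
      exact norm_integral_le_of_norm_le (ha.sub hb).norm
        (Eventually.of_forall fun x => (a x - b x).norm_coe_le_norm _)
  · intro f g hfg hf h
    have e1 : ∀ ε : ℝ, (∫ x in Ω, f x (torusProj (ε⁻¹ • x)))
        = ∫ x in Ω, g x (torusProj (ε⁻¹ • x)) := fun ε =>
      integral_congr_ae (by filter_upwards [hfg] with x hx; rw [hx])
    have e2 : (∫ x in Ω, ∫ v, f x v) = ∫ x in Ω, ∫ v, g x v :=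
      integral_congr_ae (by filter_upwards [hfg] with x hx; rw [hx])
    simpa only [e1, e2] using h
end

section
/- Let Ω ⊆ ℝ^d be open. For every φ ∈ C_c^∞(Ω) and every smooth ℤ^d-periodic function ψ on ℝ^d, one has ε^{-1} ∫_Ω φ(x) ( ψ(x/ε) − ∫_{[0,1]^d} ψ(w) dw ) dx → 0 as ε → 0⁺. (This expresses that ε^{-1}(δ_p(v − x/ε) − 1) → 0 in the sense of distributions.) -/
open MeasureTheory Filter Topology

/-- The unit cube `[0,1]^d` in `ℝ^d`, representing the torus `T^d`. -/
def cube (d : ℕ) : Set (Fin d → ℝ) := Set.Icc 0 1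

/-- A function on `ℝ^d` is `ℤ^d`-periodic. -/
def ZPeriodic {d : ℕ} (φ : (Fin d → ℝ) → ℝ) : Prop :=
  ∀ (x : Fin d → ℝ) (k : Fin d → ℤ), φ (x + fun i => (k i : ℝ)) = φ x

lemma aux_invariant {d : ℕ} {ψ : (Fin d → ℝ) → ℝ} (hψp : ZPeriodic ψ)
    (g : Submodule.span ℤ (Set.range (Pi.basisFun ℝ (Fin d)))) (x : Fin d → ℝ) :
    ψ (g +ᵥ x) = ψ x := by
  have h := ((Pi.basisFun ℝ (Fin d)).mem_span_iff_repr_mem ℤ (g : Fin d → ℝ)).mp g.2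
  choose k hk using h
  have hg : (g : Fin d → ℝ) = fun i => (k i : ℝ) := by
    funext i
    have := hk i
    simp at this
    exact this.symm
  have : g +ᵥ x = x + fun i => (k i : ℝ) := by
    rw [← hg, add_comm]; rfl
  rw [this]
  exact hψp x k

lemma aux_mean {d : ℕ} {ψ : (Fin d → ℝ) → ℝ} (hψp : ZPeriodic ψ) (y : Fin d → ℝ) :
    ∫ w in cube d, ψ (y + w) = ∫ w in cube d, ψ w := by
  have hF := ZSpan.isAddFundamentalDomain (Pi.basisFun ℝ (Fin d)) (volume : Measure (Fin d → ℝ))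
  have hc : ∀ f : (Fin d → ℝ) → ℝ, ∫ w in cube d, f w
      = ∫ w in ZSpan.fundamentalDomain (Pi.basisFun ℝ (Fin d)), f w := by
    intro f
    rw [ZSpan.fundamentalDomain_pi_basisFun]
    refine (setIntegral_congr_set ?_).symm
    exact Measure.univ_pi_Ico_ae_eq_Icc (f := (0 : Fin d → ℝ)) (g := 1)
  rw [hc, hc]
  have h2 := hF.vadd_of_comm y
  have : VAddInvariantMeasure (Submodule.span ℤ (Set.range (Pi.basisFun ℝ (Fin d))))
      (Fin d → ℝ) volume :=
    ⟨fun g s _ => measure_preimage_add volume (g : Fin d → ℝ) s⟩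
  rw [hF.setIntegral_eq h2 (aux_invariant hψp)]
  exact ((measurePreserving_add_left volume y).setIntegral_image_emb
    (measurableEmbedding_addLeft y) ψ _).symm

lemma aux_bdd {d : ℕ} {ψ : (Fin d → ℝ) → ℝ} (hψp : ZPeriodic ψ) (hc : Continuous ψ) :
    ∃ M, ∀ x, ‖ψ x‖ ≤ M := by
  obtain ⟨M, hM⟩ := (isCompact_Icc (a := (0 : Fin d → ℝ)) (b := 1)).exists_bound_of_continuousOn
    hc.continuousOn
  refine ⟨M, fun x => ?_⟩
  have h := hψp (fun i => Int.fract (x i)) (fun i => ⌊x i⌋)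
  have hx : ((fun i => Int.fract (x i)) + fun i => ((⌊x i⌋ : ℤ) : ℝ)) = x := by
    funext i; simp
  rw [hx] at h
  rw [h]
  exact hM _ ⟨fun i => Int.fract_nonneg _, fun i => (Int.fract_lt_one _).le⟩

lemma aux_cube_vol (d : ℕ) : volume.real (cube d) = 1 := by
  rw [cube, Measure.real, Real.volume_Icc_pi]; simp

lemma aux_avg {d : ℕ} {h f : (Fin d → ℝ) → ℝ} (hh : Continuous h) {M : ℝ}
    (hM : ∀ x, ‖h x‖ ≤ M) {ε : ℝ} (h0 : ∀ x, ∫ w in cube d, h (x + ε • w) = 0)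
    (hf : Continuous f) (hfs : HasCompactSupport f) {B : ℝ}
    (hB : ∀ w ∈ cube d, ‖∫ x, (f x - f (x - ε • w)) * h x‖ ≤ B) :
    ‖∫ x, f x * h x‖ ≤ B := by
  have hfi : Integrable f := hf.integrable_of_hasCompactSupport hfs
  have hvol : volume (cube d) < ⊤ := isCompact_Icc.measure_lt_top
  have : IsFiniteMeasure (volume.restrict (cube d)) := ⟨by simpa using hvol⟩
  have hmul : ∀ g : (Fin d → ℝ) → ℝ, Integrable g → Integrable (fun x => g x * h x) := fun g hg =>
    hg.mul_bdd hh.aestronglyMeasurable (.of_forall hM)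
  have hF : Integrable (Function.uncurry fun (w x : Fin d → ℝ) => f x * h (x + ε • w))
      ((volume.restrict (cube d)).prod volume) := by
    have h1 : Integrable (fun p : (Fin d → ℝ) × (Fin d → ℝ) => f p.2)
      ((volume.restrict (cube d)).prod volume) := hfi.comp_snd _
    refine h1.mul_bdd (c := M) ?_ (.of_forall fun p => hM (p.2 + ε • p.1))
    exact Continuous.aestronglyMeasurable (by fun_prop)
  have hsw := integral_integral_swap hF
  have hz : ∫ w in cube d, ∫ x, f x * h (x + ε • w) = 0 := by
    rw [hsw]
    simp_rw [integral_const_mul, h0]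
    simp
  have hsh : ∀ w : Fin d → ℝ, ∫ x, (f x - f (x - ε • w)) * h x
      = (∫ x, f x * h x) - ∫ x, f x * h (x + ε • w) := by
    intro w
    simp_rw [sub_mul]
    rw [integral_sub (hmul _ hfi) (hmul _ (hfi.comp_sub_right (ε • w)))]
    congr 1
    rw [← integral_add_right_eq_self (fun x => f (x - ε • w) * h x) (ε • w)]
    simp
  have key : ∫ w in cube d, ∫ x, (f x - f (x - ε • w)) * h x = ∫ x, f x * h x := by
    simp_rw [hsh]
    have hI : Integrable (fun w => ∫ x, f x * h (x + ε • w)) (volume.restrict (cube d)) :=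
      hF.integral_prod_left
    rw [integral_sub (integrable_const _) hI, hz]
    simp [aux_cube_vol]
  rw [← key]
  have := norm_setIntegral_le_of_norm_le_const hvol hB
  rwa [aux_cube_vol, mul_one] at this

lemma aux_second {d : ℕ} {φ : (Fin d → ℝ) → ℝ} (hφ : ContDiff ℝ (⊤ : ℕ∞) φ)
    (hφs : HasCompactSupport φ) : ∃ L : ℝ, 0 ≤ L ∧ ∀ a b x : Fin d → ℝ,
      ‖(φ x - φ (x - a)) - (φ (x - b) - φ (x - b - a))‖ ≤ L * ‖a‖ * ‖b‖ := by
  have h1 : ContDiff ℝ 1 (fderiv ℝ φ) := hφ.fderiv_right (by norm_cast)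
  obtain ⟨L, hL⟩ := h1.lipschitzWith_of_hasCompactSupport (hφs.fderiv ℝ) (by simp)
  refine ⟨L, L.2, fun a b x => ?_⟩
  have hd : Differentiable ℝ φ := hφ.differentiable (by simp)
  have hD : ∀ y ∈ Set.univ, HasFDerivWithinAt (fun x => φ x - φ (x - a))
      (fderiv ℝ φ y - fderiv ℝ φ (y - a)) Set.univ y := by
    intro y _
    refine HasFDerivAt.hasFDerivWithinAt ?_
    refine (hd y).hasFDerivAt.sub ?_
    exact (hasFDerivAt_comp_sub a).mpr (hd (y - a)).hasFDerivAt
  have := convex_univ.norm_image_sub_le_of_norm_hasFDerivWithin_le (C := L * ‖a‖) hD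
    (fun y _ => by
      have := hL.dist_le_mul y (y - a)
      rw [dist_eq_norm, dist_eq_norm] at this
      simpa using this) (Set.mem_univ (x - b)) (Set.mem_univ x)
  simpa using this

/-- for every `φ ∈ C_c^∞(Ω)` and every smooth `ℤ^d`-periodic `ψ`,
`ε⁻¹ ∫_Ω φ(x) (ψ(x/ε) − ∫_{[0,1]^d} ψ(w) dw) dx → 0` as `ε → 0⁺`; i.e.
`ε⁻¹(δ_p(v − x/ε) − 1) → 0` in `𝒟'`. -/
theorem statement9 (d : ℕ) (Ω : Set (Fin d → ℝ)) (hΩ : IsOpen Ω)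
    (φ : (Fin d → ℝ) → ℝ) (hφ : ContDiff ℝ (⊤ : ℕ∞) φ) (hφs : HasCompactSupport φ)
    (hφΩ : tsupport φ ⊆ Ω)
    (ψ : (Fin d → ℝ) → ℝ) (hψ : ContDiff ℝ (⊤ : ℕ∞) ψ) (hψp : ZPeriodic ψ) :
    Tendsto
      (fun ε : ℝ => ε⁻¹ * ∫ x in Ω, φ x * (ψ (ε⁻¹ • x) - ∫ w in cube d, ψ w))
      (𝓝[>] (0:ℝ)) (𝓝 0) := by
  obtain ⟨L, hL0, hL⟩ := aux_second hφ hφs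
  obtain ⟨M, hM⟩ := aux_bdd hψp hψ.continuous
  set c := ∫ w in cube d, ψ w with hc
  have hM0 : 0 ≤ M := (norm_nonneg _).trans (hM 0)
  set N := M + ‖c‖ with hN
  have hN0 : 0 ≤ N := by positivity
  set K := Metric.cthickening 2 (tsupport φ) with hK
  have hKc : IsCompact K := hφs.isCompact.cthickening
  have hKt : volume K < ⊤ := hKc.measure_lt_top
  have hout : ∀ x ∉ K, ∀ b : Fin d → ℝ, ‖b‖ ≤ 2 → φ (x - b) = 0 := by
    intro x hx b hb
    by_contra hne
    refine hx (Metric.mem_cthickening_of_dist_le x (x - b) 2 _ (subset_tsupport _ hne) ?_)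
    simpa [dist_eq_norm] using hb
  have hcube : ∀ w ∈ cube d, ‖w‖ ≤ 1 := by
    intro w hw
    rw [pi_norm_le_iff_of_nonneg zero_le_one]
    intro i
    rw [Real.norm_eq_abs, abs_le]
    have h1 := hw.1 i
    have h2 := hw.2 i
    simp at h1 h2
    constructor <;> linarith
  have hvol : volume (cube d) < ⊤ := isCompact_Icc.measure_lt_top
  have main : ∀ ε ∈ Set.Ioc (0:ℝ) 1,
      ‖ε⁻¹ * ∫ x in Ω, φ x * (ψ (ε⁻¹ • x) - c)‖ ≤ ε * (L * N * volume.real K) := by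
    intro ε hε
    have hεpos : 0 < ε := hε.1
    set h : (Fin d → ℝ) → ℝ := fun x => ψ (ε⁻¹ • x) - c with hh
    have hhc : Continuous h := by
      have := hψ.continuous
      fun_prop
    have hhN : ∀ x, ‖h x‖ ≤ N := fun x => (norm_sub_le _ _).trans (add_le_add_left (hM _) _)
    have h0 : ∀ x, ∫ w in cube d, h (x + ε • w) = 0 := by
      intro x
      have e : ∀ w : Fin d → ℝ, h (x + ε • w) = ψ (ε⁻¹ • x + w) - c := by
        intro w
        simp [hh, smul_add, smul_smul, inv_mul_cancel₀ hεpos.ne']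
      simp_rw [e]
      rw [integral_sub, aux_mean hψp]
      · simp [aux_cube_vol, hc]
      · refine ContinuousOn.integrableOn_compact isCompact_Icc ?_
        have := hψ.continuous
        exact Continuous.continuousOn (by fun_prop)
      · exact integrableOn_const hvol.ne
    have hΩi : ∫ x in Ω, φ x * h x = ∫ x, φ x * h x := by
      refine setIntegral_eq_integral_of_forall_compl_eq_zero fun x hx => ?_
      rw [image_eq_zero_of_notMem_tsupport (fun hx' => hx (hφΩ hx')), zero_mul]
    have hsm : ∀ w ∈ cube d, ‖ε • w‖ ≤ ε := by
      intro w hw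
      rw [norm_smul, Real.norm_of_nonneg hεpos.le]
      exact mul_le_of_le_one_right hεpos.le (hcube w hw)
    have hbound : ‖∫ x, φ x * h x‖ ≤ L * ε * ε * N * volume.real K := by
      refine aux_avg hhc hhN h0 hφ.continuous hφs fun w hw => ?_
      refine aux_avg (f := fun x => φ x - φ (x - ε • w)) hhc hhN h0 ?_ ?_ fun v hv => ?_
      · have := hφ.continuous
        fun_prop
      · exact hφs.sub (hφs.comp_homeomorph (Homeomorph.subRight (ε • w)))
      · have ha := hsm w hw
        have hb := hsm v hv
        have hab : ‖ε • v + ε • w‖ ≤ 2 := (norm_add_le _ _).trans (by linarith [hε.2])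
        rw [← setIntegral_eq_integral_of_forall_compl_eq_zero (s := K)]
        · refine norm_setIntegral_le_of_norm_le_const hKt fun x _ => ?_
          rw [norm_mul]
          refine mul_le_mul ((hL (ε • w) (ε • v) x).trans ?_) (hhN x) (norm_nonneg _)
            (by positivity)
          gcongr
        · intro x hx
          have e0 := hout x hx 0 (by simp)
          have e1 := hout x hx (ε • w) (by linarith [hε.2])
          have e2 := hout x hx (ε • v) (by linarith [hε.2])
          have e3 := hout x hx _ hab
          rw [← sub_sub] at e3
          rw [sub_zero] at e0
          simp only [e0, e1, e2, e3]
          simp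
    rw [hΩi, norm_mul, norm_inv, Real.norm_of_nonneg hεpos.le]
    calc ε⁻¹ * ‖∫ x, φ x * h x‖ ≤ ε⁻¹ * (L * ε * ε * N * volume.real K) := by gcongr
      _ = _ := by field_simp
  refine squeeze_zero_norm' (a := fun ε => ε * (L * N * volume.real K)) ?_ ?_
  · filter_upwards [Ioc_mem_nhdsGT (zero_lt_one' ℝ)] with ε hε using main ε hε
  · have : Tendsto (fun ε : ℝ => ε * (L * N * volume.real K)) (𝓝 0)
        (𝓝 (0 * (L * N * volume.real K))) := tendsto_id.mul_const _
    rw [zero_mul] at this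
    exact this.mono_left nhdsWithin_le_nhds
end
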